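/- In any shuffle r of two infinite sequences r1 and r2 over a finite set V, the set of elements of V occurring infinitely often in r equals the union of the set of elements occurring infinitely often in r1 and the set of elements occurring infinitely often in r2; consequently, the minimal priority (under a priority function p : V → ℕ) occurring infinitely often in r is the minimum of the minimal priorities occurring infinitely often in r1 and in r2. -/

import Mathlib

/-- The set of elements occurring infinitely often in an infinite sequence. -/
def InfOcc {α : Type*} (s : ℕ → α) : Set α := {v | ∀ n, ∃ m, n ≤ m ∧ s m = v}

/-- The minimal priority occurring infinitely often. -/
noncomputable def minPrio {α : Type*} (p : α → ℕ) (s : ℕ → α) : ℕ := sInf (p '' InfOcc s)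

/-- The parity condition induced by a priority function: the set of infinite
sequences in which the minimal priority occurring infinitely often is even. -/
def ParityWin {α : Type*} (p : α → ℕ) : Set (ℕ → α) := {s | Even (minPrio p s)}

/-- The concatenation of the first `n` finite words of `u`. -/
def partialFlat {α : Type*} (u : ℕ → List α) (n : ℕ) : List α := ((List.range n).map u).flatten

/-- The infinite sequence `s` is the (infinite) concatenation `u 0 · u 1 · u 2 ⋯`
of the finite words `u n`. -/
def IsConcatOf {α : Type*} (s : ℕ → α) (u : ℕ → List α) : Prop :=
  (∀ m, ∃ n, m ≤ (partialFlat u n).length) ∧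
    ∀ (n i : ℕ) (h : i < (partialFlat u n).length), (partialFlat u n).get ⟨i, h⟩ = s i

/-- `r` is a shuffle of `r1` and `r2`: `r = u0 · u1 · u2 ⋯` for finite words `u i`
with `r1 = u0 · u2 · u4 ⋯` and `r2 = u1 · u3 · u5 ⋯`. -/
def IsShuffle {α : Type*} (r r1 r2 : ℕ → α) : Prop :=
  ∃ u : ℕ → List α, IsConcatOf r u ∧
    IsConcatOf r1 (fun n => u (2 * n)) ∧ IsConcatOf r2 (fun n => u (2 * n + 1))

theorem partialFlat_succ {α : Type*} (u : ℕ → List α) (n : ℕ) :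
    partialFlat u (n + 1) = partialFlat u n ++ u n := by
  simp [partialFlat, List.range_succ]

theorem monotone_length_partialFlat {α : Type*} (u : ℕ → List α) :
    Monotone fun n => (partialFlat u n).length :=
  monotone_nat_of_le_succ fun n => by simp [partialFlat_succ]

theorem exists_getElem_partialFlat_mem {α : Type*} (u : ℕ → List α) {n m : ℕ}
    (hnm : (partialFlat u n).length ≤ m) (N : ℕ) (h : m < (partialFlat u N).length) :
    ∃ k, n ≤ k ∧ (partialFlat u N)[m] ∈ u k := by
  induction N with
  | zero => simp [partialFlat] at h
  | succ N ih =>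
    by_cases hm : m < (partialFlat u N).length
    · obtain ⟨k, hk, hmem⟩ := ih hm
      refine ⟨k, hk, ?_⟩
      simpa only [partialFlat_succ, List.getElem_append_left hm] using hmem
    · refine ⟨N, ?_, ?_⟩
      · by_contra! hN
        have hle := monotone_length_partialFlat u (Nat.succ_le_of_lt hN)
        dsimp only [Nat.succ_eq_add_one] at hle
        omega
      · simp only [partialFlat_succ, List.getElem_append_right (not_lt.mp hm)]
        exact List.getElem_mem _

theorem IsConcatOf.mem_infOcc_iff {α : Type*} {s : ℕ → α} {u : ℕ → List α}
    (h : IsConcatOf s u) (v : α) : v ∈ InfOcc s ↔ ∀ n, ∃ k, n ≤ k ∧ v ∈ u k := by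
  constructor
  · intro hv n
    obtain ⟨m, hm, rfl⟩ := hv (partialFlat u n).length
    obtain ⟨N, hN⟩ := h.1 (m + 1)
    rw [← h.2 N m hN]
    exact exists_getElem_partialFlat_mem u hm N hN
  · intro hv n
    obtain ⟨K, hK⟩ := h.1 n
    obtain ⟨k, hk, hmem⟩ := hv K
    obtain ⟨i, hi, rfl⟩ := List.getElem_of_mem hmem
    refine ⟨(partialFlat u k).length + i,
      (hK.trans (monotone_length_partialFlat u hk)).trans (Nat.le_add_right _ _), ?_⟩
    rw [← h.2 (k + 1) _ (by simpa [partialFlat_succ] using hi)]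
    simp [partialFlat_succ]

theorem IsShuffle.infOcc_eq_union {α : Type*} {r r1 r2 : ℕ → α} (hr : IsShuffle r r1 r2) :
    InfOcc r = InfOcc r1 ∪ InfOcc r2 := by
  obtain ⟨u, h, h1, h2⟩ := hr
  ext v
  rw [Set.mem_union, h.mem_infOcc_iff, h1.mem_infOcc_iff, h2.mem_infOcc_iff]
  constructor
  · intro hv
    by_contra! hne
    obtain ⟨⟨a, ha⟩, b, hb⟩ := hne
    obtain ⟨k, hk, hmem⟩ := hv (2 * a + 2 * b)
    obtain ⟨j, rfl | rfl⟩ := k.even_or_odd'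
    · exact ha j (by omega) hmem
    · exact hb j (by omega) hmem
  · rintro (hv | hv) n
    · obtain ⟨k, hk, hmem⟩ := hv n
      exact ⟨2 * k, by omega, hmem⟩
    · obtain ⟨k, hk, hmem⟩ := hv n
      exact ⟨2 * k + 1, by omega, hmem⟩

theorem infOcc_nonempty {α : Type*} [Finite α] (s : ℕ → α) : (InfOcc s).Nonempty := by
  obtain ⟨v, hv⟩ := Finite.exists_infinite_fiber s
  refine ⟨v, fun n => ?_⟩
  obtain ⟨m, hm, hnm⟩ := (Set.infinite_coe_iff.mp hv).exists_gt n
  exact ⟨m, hnm.le, hm⟩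

/-- in any shuffle `r` of two infinite sequences `r1`, `r2` over a
finite set `V`, the set of elements occurring infinitely often in `r` is the union
of those of `r1` and `r2`; consequently, for every priority function `p : V → ℕ`,
the minimal priority occurring infinitely often in `r` is the minimum of the
minimal priorities occurring infinitely often in `r1` and in `r2`. -/
theorem shuffle_infOcc_union {V : Type} [Fintype V] (r r1 r2 : ℕ → V)
    (hr : IsShuffle r r1 r2) :
    InfOcc r = InfOcc r1 ∪ InfOcc r2 ∧
      ∀ p : V → ℕ, minPrio p r = min (minPrio p r1) (minPrio p r2) := by
  refine ⟨hr.infOcc_eq_union, fun p => ?_⟩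
  rw [minPrio, hr.infOcc_eq_union, Set.image_union]
  exact csInf_union (OrderBot.bddBelow _) ((infOcc_nonempty r1).image p)
    (OrderBot.bddBelow _) ((infOcc_nonempty r2).image p)
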